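/- arXiv:2508.21379 — 2 statements merged into one kernel-verified Lean document; each statement's English description precedes it below -/
import Mathlib

section
/- A consistent path system P on the vertex set [n] is strictly metric if and only if there exists a pseudometric ρ on [n] such that T(ρ) = T(P). -/
open SimpleGraph

/-- A path system on a simple graph `G`: for every pair of distinct vertices a chosen
simple path between them, with `P_{u,v} = P_{v,u}`. -/
structure PathSystem {V : Type*} (G : SimpleGraph V) where
  path : ∀ u v : V, u ≠ v → G.Path u v
  symm : ∀ (u v : V) (h : u ≠ v), (path v u (Ne.symm h)).val = (path u v h).val.reverse

namespace PathSystem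

variable {V : Type*} {G : SimpleGraph V}

/-- A path system is consistent if whenever `a` lies on `P_{u,v}`, the path `P_{u,v}` is
the concatenation of `P_{u,a}` and `P_{a,v}`. -/
def Consistent (P : PathSystem G) : Prop :=
  ∀ (u v : V) (huv : u ≠ v) (a : V) (hua : u ≠ a) (hav : a ≠ v),
    a ∈ (P.path u v huv).val.support →
      (P.path u v huv).val = (P.path u a hua).val.append (P.path a v hav).val

/-- A path system is neighborly if the chosen path between the endpoints of each edge is
that single edge. -/
def Neighborly (P : PathSystem G) : Prop :=
  ∀ (u v : V) (h : G.Adj u v),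
    (P.path u v h.ne).val = SimpleGraph.Walk.cons h SimpleGraph.Walk.nil

/-- The `w`-weight of a walk: the sum of the weights of its edges. -/
def wlen (w : Sym2 V → ℝ) {u v : V} (Q : G.Walk u v) : ℝ :=
  (Q.edges.map w).sum

/-- A path system is metric if for some positive edge weights every chosen path is a
shortest path between its endpoints. -/
def Metric (P : PathSystem G) : Prop :=
  ∃ w : Sym2 V → ℝ, (∀ e ∈ G.edgeSet, 0 < w e) ∧
    ∀ (u v : V) (h : u ≠ v) (Q : G.Path u v),
      wlen w (P.path u v h).val ≤ wlen w Q.val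

/-- A path system is strictly metric if for some positive edge weights every chosen path
is the unique shortest path between its endpoints. -/
def StrictlyMetric (P : PathSystem G) : Prop :=
  ∃ w : Sym2 V → ℝ, (∀ e ∈ G.edgeSet, 0 < w e) ∧
    ∀ (u v : V) (h : u ≠ v) (Q : G.Path u v), Q ≠ P.path u v h →
      wlen w (P.path u v h).val < wlen w Q.val

end PathSystem

/-- A pointed triple `{a,b;c}` on `[n]`: an unordered pair `{a,b}` of distinct vertices
together with a distinguished third vertex `c ∉ {a,b}`. -/
abbrev PointedTriple (n : ℕ) :=
  {p : Sym2 (Fin n) × Fin n // ¬ p.1.IsDiag ∧ p.2 ∉ p.1}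

/-- `ρ` is a pseudometric on `Fin n`. -/
def IsPseudometric {n : ℕ} (ρ : Fin n → Fin n → ℝ) : Prop :=
  (∀ x, ρ x x = 0) ∧ (∀ x y, ρ x y = ρ y x) ∧ ∀ x y z, ρ x z ≤ ρ x y + ρ y z

/-- `ρ` is a metric on `Fin n`. -/
def IsMetric {n : ℕ} (ρ : Fin n → Fin n → ℝ) : Prop :=
  IsPseudometric ρ ∧ ∀ x y : Fin n, x ≠ y → 0 < ρ x y

/-- `T(ρ)`: the set of pointed triples `{a,b;c}` that are colinear w.r.t. `ρ`, i.e.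
`ρ(a,b) = ρ(a,c) + ρ(c,b)`. -/
def Tpm {n : ℕ} (ρ : Fin n → Fin n → ℝ) : Set (PointedTriple n) :=
  {t | ∃ a b : Fin n, t.val.1 = s(a, b) ∧ ρ a b = ρ a t.val.2 + ρ t.val.2 b}

/-- `T(P)`: the set of pointed triples `{a,b;c}` with `c` a vertex of the path `P_{a,b}`. -/
def Tsys {n : ℕ} (P : PathSystem (completeGraph (Fin n))) : Set (PointedTriple n) :=
  {t | ∃ (a b : Fin n) (h : a ≠ b),
    t.val.1 = s(a, b) ∧ t.val.2 ∈ (P.path a b h).val.support}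

namespace PathSystem

variable {V : Type*} {G : SimpleGraph V}

theorem wlen_append (w : Sym2 V → ℝ) {x y z : V} (p : G.Walk x y) (q : G.Walk y z) :
    wlen w (p.append q) = wlen w p + wlen w q := by
  simp [wlen, SimpleGraph.Walk.edges_append]

theorem wlen_reverse (w : Sym2 V → ℝ) {x y : V} (p : G.Walk x y) :
    wlen w p.reverse = wlen w p := by
  simp [wlen, SimpleGraph.Walk.edges_reverse, List.sum_reverse]

theorem wlen_cons (w : Sym2 V → ℝ) {x y z : V} (h : G.Adj x y) (p : G.Walk y z) :
    wlen w (SimpleGraph.Walk.cons h p) = w s(x, y) + wlen w p := by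
  simp [wlen]

theorem wlen_nonneg {w : Sym2 V → ℝ} (hw : ∀ e ∈ G.edgeSet, 0 < w e) {x y : V}
    (p : G.Walk x y) : 0 ≤ wlen w p := by
  refine List.sum_nonneg fun r hr => ?_
  obtain ⟨e, he, rfl⟩ := List.mem_map.1 hr
  exact (hw e (p.edges_subset_edgeSet he)).le

/-- If `l₁` has no duplicates and is contained in the edge list of `p`, its total weight is at
most that of `p`. -/
theorem sum_le_wlen {w : Sym2 V → ℝ} (hw : ∀ e ∈ G.edgeSet, 0 < w e) {x y : V}
    (p : G.Walk x y) {l : List (Sym2 V)} (hl : l.Nodup) (hs : l ⊆ p.edges) :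
    (l.map w).sum ≤ wlen w p := by
  obtain ⟨l', hperm, hsub⟩ := List.subperm_of_subset hl hs
  rw [← (hperm.map w).sum_eq]
  refine (hsub.map w).sum_le_sum fun r hr => ?_
  obtain ⟨e, he, rfl⟩ := List.mem_map.1 hr
  exact (hw e (p.edges_subset_edgeSet he)).le

theorem length_symm (P : PathSystem G) {u v : V} (h : u ≠ v) :
    (P.path v u h.symm).val.length = (P.path u v h).val.length := by
  rw [P.symm u v h, SimpleGraph.Walk.length_reverse]

theorem mem_support_symm (P : PathSystem G) {u v c : V} (h : u ≠ v) :
    c ∈ (P.path v u h.symm).val.support ↔ c ∈ (P.path u v h).val.support := by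
  rw [P.symm u v h, SimpleGraph.Walk.support_reverse, List.mem_reverse]

theorem Consistent.notMem_support {P : PathSystem G} (hP : P.Consistent) {x y z : V}
    (hyz : y ≠ z) (hyx : y ≠ x) (hxz : x ≠ z) (hx : x ∈ (P.path y z hyz).val.support) :
    y ∉ (P.path x z hxz).val.support := by
  intro hy
  have h := (P.path y z hyz).property
  rw [hP y z hyz x hyx hxz hx] at h
  have hd := h.support_nodup
  rw [SimpleGraph.Walk.support_append, List.nodup_append] at hd
  rw [← SimpleGraph.Walk.cons_tail_support, List.mem_cons] at hy
  exact hd.2.2 y (SimpleGraph.Walk.start_mem_support _) y (hy.resolve_left hyx) rfl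

section Distance

variable [DecidableEq V]

theorem wlen_bypass_le {w : Sym2 V → ℝ} (hw : ∀ e ∈ G.edgeSet, 0 < w e) {x y : V}
    (p : G.Walk x y) : wlen w p.bypass ≤ wlen w p :=
  sum_le_wlen hw p p.bypass_isPath.isTrail.edges_nodup p.edges_bypass_subset_edges

theorem wlen_bypass_lt {w : Sym2 V → ℝ} (hw : ∀ e ∈ G.edgeSet, 0 < w e) {x y : V}
    (p : G.Walk x y) {e : Sym2 V} (he : e ∈ p.edges) (he' : e ∉ p.bypass.edges) :
    wlen w p.bypass < wlen w p := by
  have h := sum_le_wlen hw p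
    (List.nodup_cons.2 ⟨he', p.bypass_isPath.isTrail.edges_nodup⟩)
    (List.cons_subset.2 ⟨he, p.edges_bypass_subset_edges⟩)
  have := hw e (p.edges_subset_edgeSet he)
  rw [List.map_cons, List.sum_cons] at h
  change w e + wlen w p.bypass ≤ _ at h
  linarith

/-- The weight of the chosen path between two vertices, and `0` on the diagonal. -/
def dist (P : PathSystem G) (w : Sym2 V → ℝ) (x y : V) : ℝ :=
  if h : x = y then 0 else wlen w (P.path x y h).val

@[simp]
theorem dist_self (P : PathSystem G) (w : Sym2 V → ℝ) (x : V) : P.dist w x x = 0 := by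
  simp [dist]

theorem dist_of_ne (P : PathSystem G) (w : Sym2 V → ℝ) {x y : V} (h : x ≠ y) :
    P.dist w x y = wlen w (P.path x y h).val := by
  simp [dist, h]

theorem dist_comm (P : PathSystem G) (w : Sym2 V → ℝ) (x y : V) :
    P.dist w x y = P.dist w y x := by
  by_cases h : x = y
  · rw [h]
  · rw [dist_of_ne P w h, dist_of_ne P w (Ne.symm h), P.symm x y h, wlen_reverse]

theorem dist_nonneg (P : PathSystem G) {w : Sym2 V → ℝ} (hw : ∀ e ∈ G.edgeSet, 0 < w e)
    (x y : V) : 0 ≤ P.dist w x y := by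
  rw [dist]
  split_ifs
  exacts [le_rfl, wlen_nonneg hw _]

theorem dist_le_wlen (P : PathSystem G) {w : Sym2 V → ℝ}
    (hs : ∀ (u v : V) (h : u ≠ v) (Q : G.Path u v), Q ≠ P.path u v h →
      wlen w (P.path u v h).val < wlen w Q.val) {x y : V} (h : x ≠ y) (Q : G.Path x y) :
    P.dist w x y ≤ wlen w Q.val := by
  rw [dist_of_ne P w h]
  by_cases hQ : Q = P.path x y h
  · rw [hQ]
  · exact (hs x y h Q hQ).le

theorem dist_triangle (P : PathSystem G) {w : Sym2 V → ℝ} (hw : ∀ e ∈ G.edgeSet, 0 < w e)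
    (hs : ∀ (u v : V) (h : u ≠ v) (Q : G.Path u v), Q ≠ P.path u v h →
      wlen w (P.path u v h).val < wlen w Q.val) (x y z : V) :
    P.dist w x z ≤ P.dist w x y + P.dist w y z := by
  by_cases hxz : x = z
  · subst hxz
    rw [dist_self]
    exact add_nonneg (dist_nonneg P hw _ _) (dist_nonneg P hw _ _)
  by_cases hxy : x = y
  · simp [hxy]
  by_cases hyz : y = z
  · simp [hyz]
  rw [dist_of_ne P w hxy, dist_of_ne P w hyz, ← wlen_append]
  exact (dist_le_wlen P hs hxz ⟨_, SimpleGraph.Walk.bypass_isPath _⟩).trans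
    (wlen_bypass_le hw _)

theorem Consistent.dist_eq_add_iff {P : PathSystem G} (hP : P.Consistent) {w : Sym2 V → ℝ}
    (hw : ∀ e ∈ G.edgeSet, 0 < w e)
    (hs : ∀ (u v : V) (h : u ≠ v) (Q : G.Path u v), Q ≠ P.path u v h →
      wlen w (P.path u v h).val < wlen w Q.val) {x y z : V}
    (hxy : x ≠ y) (hyz : y ≠ z) (hxz : x ≠ z) :
    P.dist w x z = P.dist w x y + P.dist w y z ↔ y ∈ (P.path x z hxz).val.support := by
  rw [dist_of_ne P w hxy, dist_of_ne P w hyz, dist_of_ne P w hxz, ← wlen_append]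
  refine ⟨fun h => ?_, fun h => by rw [hP x z hxz y hxy hyz h]⟩
  by_contra hy
  set p := (P.path x y hxy).val.append (P.path y z hyz).val with hp
  by_cases hb : (⟨p.bypass, p.bypass_isPath⟩ : G.Path x z) = P.path x z hxz
  · have hb' : p.bypass = (P.path x z hxz).val := congrArg Subtype.val hb
    have hnil : ¬ (P.path y z hyz).val.Nil := SimpleGraph.Walk.not_nil_of_ne hyz
    have he : s(y, (P.path y z hyz).val.snd) ∈ p.edges := by
      rw [hp, SimpleGraph.Walk.edges_append, List.mem_append]
      exact Or.inr (SimpleGraph.Walk.mk_start_snd_mem_edges hnil)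
    have := wlen_bypass_lt hw p he fun h' => hy <| by
      rw [← hb']
      exact SimpleGraph.Walk.fst_mem_support_of_mem_edges _ h'
    rw [hb'] at this
    exact this.ne h
  · exact ((hs x z hxz _ hb).trans_le (wlen_bypass_le hw p)).ne h

end Distance

section Weight

open Classical in
/-- The weight of an edge `s(x, y)`: the value `ρ x y` if the chosen path between `x` and `y` is
that edge, and twice that value otherwise. -/
noncomputable def weight (P : PathSystem G) (ρ : V → V → ℝ) (hρ : ∀ x y, ρ x y = ρ y x) :
    Sym2 V → ℝ :=
  Sym2.lift ⟨fun x y => if ∃ h : x ≠ y, (P.path x y h).val.length = 1 then ρ x y else 2 * ρ x y,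
    fun x y => by
      have : (∃ h : x ≠ y, (P.path x y h).val.length = 1) ↔
          ∃ h : y ≠ x, (P.path y x h).val.length = 1 :=
        ⟨fun ⟨h, h'⟩ => ⟨h.symm, by rwa [P.length_symm]⟩,
          fun ⟨h, h'⟩ => ⟨h.symm, by rwa [P.length_symm]⟩⟩
      simp only [this, hρ x y]⟩

variable {P : PathSystem G} {ρ : V → V → ℝ} {hρ : ∀ x y, ρ x y = ρ y x}

theorem weight_of_length_eq_one {x y : V} (h : x ≠ y) (h' : (P.path x y h).val.length = 1) :
    P.weight ρ hρ s(x, y) = ρ x y := by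
  simp [weight, h, h']

theorem weight_of_length_ne_one {x y : V} (h : x ≠ y) (h' : (P.path x y h).val.length ≠ 1) :
    P.weight ρ hρ s(x, y) = 2 * ρ x y := by
  simp [weight, h, h']

theorem le_weight {x y : V} (h : x ≠ y) (hpos : 0 < ρ x y) : ρ x y ≤ P.weight ρ hρ s(x, y) := by
  by_cases h' : (P.path x y h).val.length = 1
  · rw [weight_of_length_eq_one h h']
  · rw [weight_of_length_ne_one h h']
    linarith

theorem length_eq_one_of_weight_le {x y : V} (h : x ≠ y) (hpos : 0 < ρ x y)
    (hle : P.weight ρ hρ s(x, y) ≤ ρ x y) : (P.path x y h).val.length = 1 := by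
  by_contra h'
  rw [weight_of_length_ne_one h h'] at hle
  linarith

theorem walk_eq_cons_nil {x y : V} (h : G.Adj x y) (p : G.Walk x y) (hp : p.length = 1) :
    p = SimpleGraph.Walk.cons h SimpleGraph.Walk.nil := by
  cases p with
  | nil => simp at hp
  | cons h' q =>
    cases q with
    | nil => rfl
    | cons h'' r => simp at hp

theorem Consistent.wlen_weight_path (hP : P.Consistent)
    (hT : ∀ (x y z : V) (_ : x ≠ y) (_ : y ≠ z) (hxz : x ≠ z),
      y ∈ (P.path x z hxz).val.support → ρ x z = ρ x y + ρ y z)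
    {u v : V} (huv : u ≠ v) : wlen (P.weight ρ hρ) (P.path u v huv).val = ρ u v := by
  induction hk : (P.path u v huv).val.length using Nat.strong_induction_on generalizing u v with
  | _ k ih =>
    by_cases h1 : k = 1
    · rw [h1] at hk
      have hadj := SimpleGraph.Walk.adj_of_length_eq_one hk
      rw [walk_eq_cons_nil hadj _ hk, wlen_cons, weight_of_length_eq_one huv hk]
      simp [wlen]
    · have hpos {a b : V} (hab : a ≠ b) : 0 < (P.path a b hab).val.length :=
        Nat.pos_of_ne_zero fun h0 => hab (SimpleGraph.Walk.eq_of_length_eq_zero h0)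
      have hlen := hpos huv
      have hpath := (P.path u v huv).property
      set c := (P.path u v huv).val.getVert 1 with hc
      have huc : u ≠ c := fun h => by
        have := (hpath.getVert_eq_start_iff (i := 1) (by omega)).1 h.symm
        omega
      have hcv : c ≠ v := fun h => by
        have := (hpath.getVert_eq_end_iff (i := 1) (by omega)).1 h
        omega
      have hmem : c ∈ (P.path u v huv).val.support := SimpleGraph.Walk.getVert_mem_support _ _
      have happ := hP u v huv c huc hcv hmem
      have hl := congrArg SimpleGraph.Walk.length happ
      rw [SimpleGraph.Walk.length_append] at hl
      have := hpos huc
      have := hpos hcv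
      rw [happ, wlen_append, ih _ (by omega) huc rfl, ih _ (by omega) hcv rfl,
        hT u c v huc hcv huv hmem]

theorem le_wlen_weight (hpos : ∀ x y, x ≠ y → 0 < ρ x y) (hself : ∀ x, ρ x x = 0)
    (htri : ∀ x y z, ρ x z ≤ ρ x y + ρ y z) {u v : V} (Q : G.Walk u v) :
    ρ u v ≤ wlen (P.weight ρ hρ) Q := by
  induction Q with
  | nil => simp [wlen, hself]
  | @cons a b c h q ih =>
    rw [wlen_cons]
    exact (htri a b c).trans (add_le_add (le_weight h.ne (hpos _ _ h.ne)) ih)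

theorem Consistent.eq_path_of_wlen_weight_le (hP : P.Consistent)
    (hpos : ∀ x y, x ≠ y → 0 < ρ x y) (hself : ∀ x, ρ x x = 0)
    (htri : ∀ x y z, ρ x z ≤ ρ x y + ρ y z)
    (hT : ∀ (x y z : V) (_ : x ≠ y) (_ : y ≠ z) (hxz : x ≠ z),
      ρ x z = ρ x y + ρ y z → y ∈ (P.path x z hxz).val.support)
    {u v : V} (huv : u ≠ v) (Q : G.Walk u v) (hQ : Q.IsPath)
    (hle : wlen (P.weight ρ hρ) Q ≤ ρ u v) : Q = (P.path u v huv).val := by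
  induction Q with
  | nil => exact absurd rfl huv
  | @cons a b c h q ih =>
    rw [wlen_cons] at hle
    have hab := h.ne
    have h1 := le_weight (P := P) (hρ := hρ) hab (hpos _ _ hab)
    have h2 := le_wlen_weight (P := P) (hρ := hρ) hpos hself htri q
    have h3 := htri a b c
    have hedge := walk_eq_cons_nil h _
      (length_eq_one_of_weight_le (P := P) (hρ := hρ) hab (hpos _ _ hab) (by linarith))
    by_cases hbc : b = c
    · subst hbc
      rw [hedge, (SimpleGraph.Walk.isPath_iff_nil.1 hQ.of_cons).eq_nil]
    · have hq := ih hbc hQ.of_cons (by linarith)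
      rw [hP a c huv b hab hbc (hT a b c hab hbc huv (by linarith)), hedge, ← hq]
      rfl

end Weight

theorem strictlyMetric_of_card_le_two [Fintype V] (hV : Fintype.card V ≤ 2) (P : PathSystem G) :
    P.StrictlyMetric := by
  refine ⟨fun _ => 1, fun _ _ => one_pos, fun u v h Q hQ => absurd ?_ hQ⟩
  have hlen (R : G.Path u v) : R.val.length = 1 := by
    have h1 := R.property.length_lt
    have h2 : R.val.length ≠ 0 := fun h0 => h (SimpleGraph.Walk.eq_of_length_eq_zero h0)
    omega
  have hadj := SimpleGraph.Walk.adj_of_length_eq_one (hlen Q)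
  exact Subtype.ext ((walk_eq_cons_nil hadj _ (hlen Q)).trans
    (walk_eq_cons_nil hadj _ (hlen _)).symm)

end PathSystem

section PointedTriple

variable {n : ℕ}

/-- The pointed triple `{a,b;c}`. -/
def PointedTriple.mk (a b c : Fin n) (hac : a ≠ c) (hcb : c ≠ b) (hab : a ≠ b) :
    PointedTriple n :=
  ⟨(s(a, b), c), by simpa using hab, by simp [hac.symm, hcb]⟩

theorem mk_mem_Tpm {ρ : Fin n → Fin n → ℝ} (hρ : ∀ x y, ρ x y = ρ y x) {a b c : Fin n}
    (hac : a ≠ c) (hcb : c ≠ b) (hab : a ≠ b) :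
    PointedTriple.mk a b c hac hcb hab ∈ Tpm ρ ↔ ρ a b = ρ a c + ρ c b := by
  refine ⟨?_, fun h => ⟨a, b, rfl, h⟩⟩
  rintro ⟨a', b', he, h⟩
  change s(a, b) = s(a', b') at he
  change ρ a' b' = ρ a' c + ρ c b' at h
  rcases Sym2.eq_iff.1 he with ⟨rfl, rfl⟩ | ⟨rfl, rfl⟩
  · exact h
  · rw [hρ a b, h, hρ a c, hρ c b, add_comm]

theorem mk_mem_Tsys {P : PathSystem (completeGraph (Fin n))} {a b c : Fin n}
    (hac : a ≠ c) (hcb : c ≠ b) (hab : a ≠ b) :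
    PointedTriple.mk a b c hac hcb hab ∈ Tsys P ↔ c ∈ (P.path a b hab).val.support := by
  refine ⟨?_, fun h => ⟨a, b, hab, rfl, h⟩⟩
  rintro ⟨a', b', h', he, h⟩
  change s(a, b) = s(a', b') at he
  change c ∈ _ at h
  rcases Sym2.eq_iff.1 he with ⟨rfl, rfl⟩ | ⟨rfl, rfl⟩
  · exact h
  · exact (P.mem_support_symm hab).1 h

theorem Tpm_eq_Tsys_iff {ρ : Fin n → Fin n → ℝ} (hρ : ∀ x y, ρ x y = ρ y x)
    {P : PathSystem (completeGraph (Fin n))} :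
    Tpm ρ = Tsys P ↔ ∀ (a c b : Fin n) (_ : a ≠ c) (_ : c ≠ b) (hab : a ≠ b),
      ρ a b = ρ a c + ρ c b ↔ c ∈ (P.path a b hab).val.support := by
  refine ⟨fun h a c b hac hcb hab => ?_, fun h => Set.ext ?_⟩
  · rw [← mk_mem_Tpm hρ hac hcb hab, h, mk_mem_Tsys hac hcb hab]
  · rintro ⟨⟨e, c⟩, he, hc⟩
    induction e with
    | _ a b =>
      have hab : a ≠ b := by simpa using he
      have hc' : ¬ (c = a ∨ c = b) := by simpa using hc
      rw [not_or] at hc'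
      exact (mk_mem_Tpm hρ (Ne.symm hc'.1) hc'.2 hab).trans
        ((h a c b (Ne.symm hc'.1) hc'.2 hab).trans (mk_mem_Tsys (Ne.symm hc'.1) hc'.2 hab).symm)

theorem IsPseudometric.nonneg {ρ : Fin n → Fin n → ℝ} (h : IsPseudometric ρ) (x y : Fin n) :
    0 ≤ ρ x y := by
  have h1 := h.2.2 x y x
  rw [h.1, h.2.1 y x] at h1
  linarith

theorem IsPseudometric.isMetric_of_Tpm_eq_Tsys {ρ : Fin n → Fin n → ℝ} (h : IsPseudometric ρ)
    {P : PathSystem (completeGraph (Fin n))} (hP : P.Consistent) (hT : Tpm ρ = Tsys P)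
    (hn : 2 < n) : IsMetric ρ := by
  refine ⟨h, fun x y hxy => (h.nonneg x y).lt_of_ne fun h0 => ?_⟩
  obtain ⟨z, -, hz⟩ := Finset.exists_mem_notMem_of_card_lt_card (s := {x, y}) (t := Finset.univ)
    (Finset.card_le_two.trans_lt (by simpa using hn))
  obtain ⟨hzx, hzy⟩ : z ≠ x ∧ z ≠ y := by simpa using hz
  rw [Tpm_eq_Tsys_iff h.2.1] at hT
  have h1 := h.2.2 x y z
  have h2 := h.2.2 y x z
  have h3 := h.2.1 x y
  exact hP.notMem_support (Ne.symm hzy) (Ne.symm hxy) (Ne.symm hzx)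
    ((hT y x z (Ne.symm hxy) (Ne.symm hzx) (Ne.symm hzy)).1 (by linarith))
    ((hT x y z hxy (Ne.symm hzy) (Ne.symm hzx)).1 (by linarith))

end PointedTriple

theorem strictly_metric_iff_pseudometric_triples (n : ℕ)
    (P : PathSystem (completeGraph (Fin n))) (hP : P.Consistent) :
    P.StrictlyMetric ↔ ∃ ρ : Fin n → Fin n → ℝ, IsPseudometric ρ ∧ Tpm ρ = Tsys P := by
  constructor
  · rintro ⟨w, hw, hs⟩
    refine ⟨P.dist w, ⟨P.dist_self w, P.dist_comm w, P.dist_triangle hw hs⟩, ?_⟩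
    rw [Tpm_eq_Tsys_iff (P.dist_comm w)]
    exact fun a c b hac hcb hab => hP.dist_eq_add_iff hw hs hac hcb hab
  · rintro ⟨ρ, hρ, hT⟩
    rcases le_or_gt n 2 with hn | hn
    · exact PathSystem.strictlyMetric_of_card_le_two (by simpa using hn) P
    have hpos := (hρ.isMetric_of_Tpm_eq_Tsys hP hT hn).2
    rw [Tpm_eq_Tsys_iff hρ.2.1] at hT
    refine ⟨P.weight ρ hρ.2.1, fun e => ?_, fun u v h Q hQ => ?_⟩
    · induction e with
      | _ a b => exact fun he =>
        have hab : a ≠ b := SimpleGraph.Adj.ne (G := completeGraph (Fin n)) he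
        (hpos a b hab).trans_le (PathSystem.le_weight hab (hpos a b hab))
    · rw [hP.wlen_weight_path fun x y z hxy hyz hxz => (hT x y z hxy hyz hxz).2]
      by_contra! hle
      exact hQ <| Subtype.ext <| hP.eq_path_of_wlen_weight_le hpos hρ.1 hρ.2.2
        (fun x y z hxy hyz hxz => (hT x y z hxy hyz hxz).1) h Q.val Q.property hle
end

section
/- Let P be a strictly metric consistent path system on [n], let f be a résumé of P, and let g be any partial function from unordered pairs of [n] to [n] with g(u,v) ∉ {u,v} for all {u,v} ∈ dom(g), such that g is not a résumé of P. Then σ(f) ≠ σ(g). -/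
open SimpleGraph

/-- `f` is a résumé of the path system `P` on `[n]`: a partial function on unordered
pairs (encoded with `Option`), defined exactly on the pairs `{u,v}` whose path is not the
single edge `uv`, assigning to such a pair an internal vertex of `P_{u,v}`. -/
def IsResume {n : ℕ} (P : PathSystem (completeGraph (Fin n)))
    (f : Sym2 (Fin n) → Option (Fin n)) : Prop :=
  (∀ u : Fin n, f s(u, u) = none) ∧
  ∀ (u v : Fin n) (h : u ≠ v),
    (f s(u, v) = none ↔ (P.path u v h).val.length = 1) ∧
    ∀ c : Fin n, f s(u, v) = some c →
      c ∈ (P.path u v h).val.support ∧ c ≠ u ∧ c ≠ v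

/-- The standard basis vector `e_{x,y}` of the coordinate indexed by the unordered pair
`{x,y}`. -/
def eVec {n : ℕ} (x y : Fin n) : Sym2 (Fin n) → ℝ :=
  fun e => if e = s(x, y) then 1 else 0

lemma eVec_comm {n : ℕ} (x y : Fin n) : eVec x y = eVec y x := by
  funext e
  unfold eVec
  rw [Sym2.eq_swap]

/-- `Δ` for the ordered triple `(a,b,c)`: `e_{a,c} + e_{c,b} - e_{a,b}`. -/
def DeltaO {n : ℕ} (a b c : Fin n) : Sym2 (Fin n) → ℝ :=
  eVec a c + eVec c b - eVec a b

lemma DeltaO_comm {n : ℕ} (a b c : Fin n) : DeltaO a b c = DeltaO b a c := by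
  unfold DeltaO
  rw [eVec_comm a c, eVec_comm c b, eVec_comm a b]
  abel

/-- `Δ` for the pair `e = {a,b}` pointed at `c`. -/
def DeltaS {n : ℕ} (e : Sym2 (Fin n)) (c : Fin n) : Sym2 (Fin n) → ℝ :=
  Sym2.lift ⟨fun a b => DeltaO a b c, fun a b => DeltaO_comm a b c⟩ e

/-- `Δ_t` for a pointed triple `t = {a,b;c}`: the vector `e_{a,c} + e_{c,b} - e_{a,b}`. -/
def Delta {n : ℕ} (t : PointedTriple n) : Sym2 (Fin n) → ℝ :=
  DeltaS t.val.1 t.val.2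

noncomputable instance (n : ℕ) : Fintype (PointedTriple n) := Fintype.ofFinite _

/-- The signature `σ(f) = Σ_{e ∈ dom f} Δ_{e; f e}` of a partial function `f` from
unordered pairs to vertices. -/
noncomputable def sigmaFn {n : ℕ} (f : Sym2 (Fin n) → Option (Fin n)) :
    Sym2 (Fin n) → ℝ :=
  ∑ e : Sym2 (Fin n), (f e).elim 0 (fun c => DeltaS e c)

theorem List.Sublist.sum_map_lt_sum_map {α : Type*} {w : α → ℝ} {l₁ l₂ : List α}
    (h : l₁.Sublist l₂) (hne : l₁ ≠ l₂) (hw : ∀ x ∈ l₂, 0 < w x) :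
    (l₁.map w).sum < (l₂.map w).sum := by
  have le_of_sublist : ∀ {l₁ l₂ : List α}, l₁.Sublist l₂ → (∀ x ∈ l₂, 0 < w x) →
      (l₁.map w).sum ≤ (l₂.map w).sum := by
    intro l₁ l₂ h hw
    refine (h.map w).sum_le_sum ?_
    simpa using fun x hx => (hw x hx).le
  induction h with
  | slnil => exact absurd rfl hne
  | cons a h _ =>
    have hle := le_of_sublist h fun x hx => hw x (List.mem_cons_of_mem _ hx)
    have ha := hw a List.mem_cons_self
    simp only [List.map_cons, List.sum_cons]
    linarith
  | cons_cons a h ih =>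
    have := ih (fun e => hne (by rw [e])) fun x hx => hw x (List.mem_cons_of_mem _ hx)
    simpa using this

namespace PathSystem

variable {V : Type*} {G : SimpleGraph V}

theorem wlen_reverse_s8 (w : Sym2 V → ℝ) {u v : V} (Q : G.Walk u v) :
    wlen w Q.reverse = wlen w Q := by
  simp [wlen, List.sum_reverse]

theorem wlen_append_s8 (w : Sym2 V → ℝ) {u v x : V} (Q : G.Walk u v) (R : G.Walk v x) :
    wlen w (Q.append R) = wlen w Q + wlen w R := by
  simp [wlen]

/-- The weight of the chosen path between the two ends of a pair, and `0` on the diagonal. -/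
noncomputable def pathWeight (P : PathSystem G) (w : Sym2 V → ℝ) : Sym2 V → ℝ :=
  open Classical in
  Sym2.lift ⟨fun u v => if h : u = v then 0 else wlen w (P.path u v h).val, by
    intro u v
    by_cases h : u = v
    · simp [h]
    · beta_reduce
      rw [dif_neg h, dif_neg (Ne.symm h), P.symm u v h, wlen_reverse_s8]⟩

theorem pathWeight_mk (P : PathSystem G) (w : Sym2 V → ℝ) {u v : V} (h : u ≠ v) :
    P.pathWeight w s(u, v) = wlen w (P.path u v h).val := by
  simp [pathWeight, h]

theorem Consistent.pathWeight_add {P : PathSystem G} (hP : P.Consistent) (w : Sym2 V → ℝ)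
    {u v a : V} (huv : u ≠ v) (hua : u ≠ a) (hav : a ≠ v)
    (ha : a ∈ (P.path u v huv).val.support) :
    P.pathWeight w s(u, a) + P.pathWeight w s(a, v) = P.pathWeight w s(u, v) := by
  rw [P.pathWeight_mk w huv, P.pathWeight_mk w hua, P.pathWeight_mk w hav,
    hP u v huv a hua hav ha, wlen_append_s8]

theorem pathWeight_lt_add {P : PathSystem G} {w : Sym2 V → ℝ} (hw : ∀ e ∈ G.edgeSet, 0 < w e)
    (hmin : ∀ (u v : V) (h : u ≠ v) (Q : G.Path u v), Q ≠ P.path u v h →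
      wlen w (P.path u v h).val < wlen w Q.val)
    {u v a : V} (huv : u ≠ v) (hua : u ≠ a) (hav : a ≠ v)
    (ha : a ∉ (P.path u v huv).val.support) :
    P.pathWeight w s(u, v) < P.pathWeight w s(u, a) + P.pathWeight w s(a, v) := by
  classical
  rw [P.pathWeight_mk w huv, P.pathWeight_mk w hua, P.pathWeight_mk w hav, ← wlen_append_s8]
  set W := (P.path u a hua).val.append (P.path a v hav).val with hW
  have haW : a ∈ W.support := by simp [hW]
  by_cases hE : W.bypass.edges = W.edges
  · have hWP : W.IsPath := by
      have hb : W.bypass = W := W.bypass_eq_self_of_length_le_length_bypass <| by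
        rw [← Walk.length_edges, ← Walk.length_edges, hE]
      exact hb ▸ W.bypass_isPath
    exact hmin u v huv ⟨W, hWP⟩ fun h => ha (h ▸ haW)
  · have hlt : wlen w W.bypass < wlen w W :=
      W.edges_bypass_sublist_edges.sum_map_lt_sum_map hE
        fun e he => hw e (W.edges_subset_edgeSet he)
    by_cases hQ : (⟨W.bypass, W.bypass_isPath⟩ : G.Path u v) = P.path u v huv
    · rwa [← hQ]
    · exact (hmin u v huv _ hQ).trans hlt

theorem Consistent.length_ne_one {P : PathSystem G} (hP : P.Consistent)
    {u v a : V} (huv : u ≠ v) (hua : u ≠ a) (hav : a ≠ v)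
    (ha : a ∈ (P.path u v huv).val.support) : (P.path u v huv).val.length ≠ 1 := by
  have h₁ : (P.path u a hua).val.length ≠ 0 := fun h => hua (Walk.eq_of_length_eq_zero h)
  have h₂ : (P.path a v hav).val.length ≠ 0 := fun h => hav (Walk.eq_of_length_eq_zero h)
  rw [hP u v huv a hua hav ha, Walk.length_append]
  lia

end PathSystem

theorem dotProduct_eVec {n : ℕ} (φ : Sym2 (Fin n) → ℝ) (x y : Fin n) :
    φ ⬝ᵥ eVec x y = φ s(x, y) := by
  simp [dotProduct, eVec]

theorem dotProduct_DeltaS {n : ℕ} (φ : Sym2 (Fin n) → ℝ) (a b c : Fin n) :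
    φ ⬝ᵥ DeltaS s(a, b) c = φ s(a, c) + φ s(c, b) - φ s(a, b) := by
  simp [DeltaS, DeltaO, dotProduct_sub, dotProduct_add, dotProduct_eVec]

theorem dotProduct_sigmaFn {n : ℕ} (φ : Sym2 (Fin n) → ℝ)
    (f : Sym2 (Fin n) → Option (Fin n)) :
    φ ⬝ᵥ sigmaFn f = ∑ e, (f e).elim 0 (fun c => φ ⬝ᵥ DeltaS e c) := by
  rw [sigmaFn, dotProduct_sum]
  refine Finset.sum_congr rfl fun e _ => ?_
  cases f e <;> simp

theorem one_dotProduct_sigmaFn {n : ℕ} (f : Sym2 (Fin n) → Option (Fin n)) :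
    1 ⬝ᵥ sigmaFn f = ∑ e, (f e).elim (0 : ℝ) (fun _ => 1) := by
  rw [dotProduct_sigmaFn]
  refine Finset.sum_congr rfl fun e _ => ?_
  induction e with | _ a b => simp [dotProduct_DeltaS]

theorem IsResume.pathWeight_dotProduct_sigmaFn {n : ℕ} {P : PathSystem (completeGraph (Fin n))}
    (hP : P.Consistent) (w : Sym2 (Fin n) → ℝ) {f : Sym2 (Fin n) → Option (Fin n)}
    (hf : IsResume P f) : P.pathWeight w ⬝ᵥ sigmaFn f = 0 := by
  rw [dotProduct_sigmaFn]
  refine Finset.sum_eq_zero fun e _ => ?_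
  induction e with | _ a b
  rcases hc : f s(a, b) with _ | c
  · rfl
  · have hab : a ≠ b := by
      rintro rfl
      simp [hf.1] at hc
    obtain ⟨hmem, hca, hcb⟩ := (hf.2 a b hab).2 c hc
    simp [dotProduct_DeltaS, hP.pathWeight_add w hab hca.symm hcb hmem]

theorem signature_separates_resumes (n : ℕ)
    (P : PathSystem (completeGraph (Fin n)))
    (hP : P.Consistent) (hPm : P.StrictlyMetric)
    (f g : Sym2 (Fin n) → Option (Fin n))
    (hf : IsResume P f)
    (hg0 : ∀ u : Fin n, g s(u, u) = none)
    (hg1 : ∀ (e : Sym2 (Fin n)) (c : Fin n), g e = some c → c ∉ e)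
    (hg : ¬ IsResume P g) :
    sigmaFn f ≠ sigmaFn g := by
  intro heq
  obtain ⟨w, hw, hmin⟩ := hPm
  have hends : ∀ {u v c : Fin n}, g s(u, v) = some c → u ≠ v ∧ u ≠ c ∧ c ≠ v := by
    intro u v c hc
    have hmem := hg1 _ _ hc
    rw [Sym2.mem_iff, not_or] at hmem
    refine ⟨?_, Ne.symm hmem.1, hmem.2⟩
    rintro rfl
    simp [hg0] at hc
  have hzero : ∑ e, (g e).elim 0 (fun c => P.pathWeight w ⬝ᵥ DeltaS e c) = 0 := by
    rw [← dotProduct_sigmaFn, ← heq, hf.pathWeight_dotProduct_sigmaFn hP]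
  rw [Finset.sum_eq_zero_iff_of_nonneg] at hzero
  swap
  · intro e _
    induction e with | _ u v
    rcases hc : g s(u, v) with _ | c
    · exact le_rfl
    · obtain ⟨huv, huc, hcv⟩ := hends hc
      simp only [Option.elim_some, dotProduct_DeltaS]
      by_cases hmem : c ∈ (P.path u v huv).val.support
      · rw [hP.pathWeight_add w huv huc hcv hmem, sub_self]
      · exact sub_nonneg.2 (PathSystem.pathWeight_lt_add hw hmin huv huc hcv hmem).le
  have hmem : ∀ (u v c : Fin n) (huv : u ≠ v), g s(u, v) = some c →
      c ∈ (P.path u v huv).val.support := by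
    intro u v c huv hc
    obtain ⟨-, huc, hcv⟩ := hends hc
    by_contra hnot
    have hlt := PathSystem.pathWeight_lt_add hw hmin huv huc hcv hnot
    have := hzero s(u, v) (Finset.mem_univ _)
    simp only [hc, Option.elim_some, dotProduct_DeltaS] at this
    linarith
  have hdom : ∀ e, f e = none → g e = none := by
    intro e he
    induction e with | _ u v
    rcases hc : g s(u, v) with _ | c
    · rfl
    · obtain ⟨huv, huc, hcv⟩ := hends hc
      exact absurd ((hf.2 u v huv).1.1 he)
        (hP.length_ne_one huv huc hcv (hmem u v c huv hc))
  have hcount : ∑ e, (g e).elim (0 : ℝ) (fun _ => 1) = ∑ e, (f e).elim (0 : ℝ) (fun _ => 1) := by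
    rw [← one_dotProduct_sigmaFn, ← one_dotProduct_sigmaFn, heq]
  rw [Finset.sum_eq_sum_iff_of_le] at hcount
  swap
  · intro e _
    have := hdom e
    cases hfe : f e <;> cases hge : g e <;> simp_all
  have hnone : ∀ e, g e = none ↔ f e = none := by
    intro e
    have := hcount e (Finset.mem_univ _)
    cases hfe : f e <;> cases hge : g e <;> simp_all
  refine hg ⟨hg0, fun u v huv => ⟨(hnone _).trans (hf.2 u v huv).1, fun c hc => ?_⟩⟩
  obtain ⟨-, huc, hcv⟩ := hends hc
  exact ⟨hmem u v c huv hc, huc.symm, hcv⟩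
end
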